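/- arXiv:2303.15733 — 2 statements merged into one kernel-verified Lean document; each statement's English description precedes it below -/
import Mathlib

section
/- Let (v₁, v₂, v₃) be an orthonormal basis of ℝ³, let λ, λ₃ ∈ ℝ, and set M := λ(v₁v₁ᵀ + v₂v₂ᵀ) + λ₃v₃v₃ᵀ. Then for every unit vector u ∈ ℝ³ and every θ ∈ ℝ, tr(M(I − R_a(π,v₃)·R_a(θ,u))) = 4λ − (1 − cos θ)·[2λ − (λ + λ₃)·(1 − ⟨u,v₃⟩²)]. -/
open Matrix Real

noncomputable section

/-- The hat map: u^∧ y = u × y. -/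
def hat (u : Fin 3 → ℝ) : Matrix (Fin 3) (Fin 3) ℝ :=
  !![0, -u 2, u 1; u 2, 0, -u 0; -u 1, u 0, 0]

/-- The Rodrigues rotation R_a(θ, u) = I + sin θ · u^∧ + (1 − cos θ)·(u^∧)². -/
def Ra (θ : ℝ) (u : Fin 3 → ℝ) : Matrix (Fin 3) (Fin 3) ℝ :=
  1 + Real.sin θ • hat u + (1 - Real.cos θ) • (hat u * hat u)

theorem vecMulVec_add_vecMulVec_add_vecMulVec_eq_one {v₁ v₂ v₃ : Fin 3 → ℝ}
    (h11 : v₁ ⬝ᵥ v₁ = 1) (h22 : v₂ ⬝ᵥ v₂ = 1) (h33 : v₃ ⬝ᵥ v₃ = 1)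
    (h12 : v₁ ⬝ᵥ v₂ = 0) (h13 : v₁ ⬝ᵥ v₃ = 0) (h23 : v₂ ⬝ᵥ v₃ = 0) :
    vecMulVec v₁ v₁ + vecMulVec v₂ v₂ + vecMulVec v₃ v₃ = 1 := by
  have h : of ![v₁, v₂, v₃] * (of ![v₁, v₂, v₃])ᵀ = 1 := by
    ext i j
    change ![v₁, v₂, v₃] i ⬝ᵥ ![v₁, v₂, v₃] j = _
    fin_cases i <;> fin_cases j <;>
      simp [h11, h22, h33, h12, h13, h23, dotProduct_comm v₂ v₁, dotProduct_comm v₃ v₁,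
        dotProduct_comm v₃ v₂]
  rw [← mul_eq_one_comm.mp h]
  ext i j
  simp [mul_apply, Fin.sum_univ_three, vecMulVec_apply]

theorem hat_mul_hat (u : Fin 3 → ℝ) : hat u * hat u = vecMulVec u u - (u ⬝ᵥ u) • 1 := by
  ext i j
  fin_cases i <;> fin_cases j <;>
    simp [hat, mul_apply, Fin.sum_univ_three, vecMulVec_apply, dotProduct] <;> ring

theorem trace_hat (u : Fin 3 → ℝ) : (hat u).trace = 0 := by
  simp [hat, trace, Fin.sum_univ_three]

theorem dotProduct_hat_mulVec_self (u v : Fin 3 → ℝ) : v ⬝ᵥ hat u *ᵥ v = 0 := by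
  simp [hat, mulVec, dotProduct, Fin.sum_univ_three]
  ring

theorem Ra_pi {v : Fin 3 → ℝ} (hv : v ⬝ᵥ v = 1) : Ra π v = (2 : ℝ) • vecMulVec v v - 1 := by
  rw [Ra, hat_mul_hat, hv, Real.sin_pi, Real.cos_pi]
  module

theorem trace_Ra {u : Fin 3 → ℝ} (hu : u ⬝ᵥ u = 1) (θ : ℝ) :
    (Ra θ u).trace = 1 + 2 * Real.cos θ := by
  simp [Ra, hat_mul_hat, trace_hat, trace_vecMulVec, hu]
  ring

theorem dotProduct_Ra_mulVec_self {u v : Fin 3 → ℝ} (hu : u ⬝ᵥ u = 1) (hv : v ⬝ᵥ v = 1) (θ : ℝ) :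
    v ⬝ᵥ Ra θ u *ᵥ v = 1 - (1 - Real.cos θ) * (1 - (u ⬝ᵥ v) ^ 2) := by
  simp [Ra, hat_mul_hat, add_mulVec, sub_mulVec, smul_mulVec, dotProduct_add, dotProduct_sub,
    dotProduct_smul, dotProduct_hat_mulVec_self, vecMulVec_mulVec, hu, hv, dotProduct_comm v u]
  ring

/-- Evaluation of the modified trace function at Rₐ(π,v₃)·Rₐ(θ,u) for
M = λ(v₁v₁ᵀ + v₂v₂ᵀ) + λ₃v₃v₃ᵀ with a repeated eigenvalue λ. -/
theorem modified_trace_eval_at_pi_rotation_repeated_eig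
    (v₁ v₂ v₃ : Fin 3 → ℝ)
    (h11 : v₁ ⬝ᵥ v₁ = 1) (h22 : v₂ ⬝ᵥ v₂ = 1) (h33 : v₃ ⬝ᵥ v₃ = 1)
    (h12 : v₁ ⬝ᵥ v₂ = 0) (h13 : v₁ ⬝ᵥ v₃ = 0) (h23 : v₂ ⬝ᵥ v₃ = 0)
    (l l₃ : ℝ) (M : Matrix (Fin 3) (Fin 3) ℝ)
    (hMdef : M = l • (vecMulVec v₁ v₁ + vecMulVec v₂ v₂) + l₃ • vecMulVec v₃ v₃)
    (u : Fin 3 → ℝ) (hu : u ⬝ᵥ u = 1) (θ : ℝ) :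
    (M * (1 - Ra π v₃ * Ra θ u)).trace =
      4 * l - (1 - Real.cos θ) *
        (2 * l - (l + l₃) * (1 - (u ⬝ᵥ v₃)^2)) := by
  have hM : M = l • 1 + (l₃ - l) • vecMulVec v₃ v₃ := by
    rw [hMdef, ← vecMulVec_add_vecMulVec_add_vecMulVec_eq_one h11 h22 h33 h12 h13 h23]
    module
  have hMR : M * Ra π v₃ = (l + l₃) • vecMulVec v₃ v₃ - l • 1 := by
    rw [hM, Ra_pi h33]
    simp only [add_mul, mul_sub, smul_mul_assoc, mul_smul_comm, one_mul, mul_one,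
      vecMulVec_mul_vecMulVec, h33, one_smul]
    module
  have hv : (vecMulVec v₃ v₃ * Ra θ u).trace = v₃ ⬝ᵥ Ra θ u *ᵥ v₃ := by
    rw [vecMulVec_mul, trace_vecMulVec, dotProduct_comm, dotProduct_mulVec]
  rw [mul_sub, mul_one, ← mul_assoc, hMR, sub_mul, smul_mul_assoc, smul_mul_assoc, one_mul,
    trace_sub, trace_sub, trace_smul, trace_smul, hv, trace_Ra hu,
    dotProduct_Ra_mulVec_self hu h33, hM, trace_add, trace_smul, trace_smul, trace_vecMulVec, h33,
    trace_one]
  simp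
  ring

end
end

section
/- Let λ > 0, let 0 < k < 1/√2, and let (v₁, v₂, v₃) be an orthonormal basis of ℝ³; set M := λ·I and Ξ := 2k/(1 + √(1 + 4k²)). For each unit vector v ∈ ℝ³ define s_v := 2k/(1 + √(1 + 4k²⟨v,v₁⟩²)), θ_v := 2·arcsin(s_v), and gap(v) := max over u_p ∈ {v₂, −v₂, v₃, −v₃} of [ 4λ − λ·tr(I − R_a(π,v)·R_a(θ_v,−v₁)·R_a(θ_v,u_p)) ]. Then gap(v) ≥ 2λ·min{ k², 2Ξ²(1 − Ξ²) } for every unit vector v, and there exists a unit vector v₀ with gap(v₀) = 2λ·min{ k², 2Ξ²(1 − Ξ²) }. -/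
open Matrix Real

noncomputable section

/-- The refined synergistic gap at the unwanted critical point with axis `v`
for M = λI: the maximum over the four orthogonal warping directions
u_p ∈ {±v₂, ±v₃} of 4λ − λ·tr(I − Rₐ(π,v)·Rₐ(θ_v,−v₁)·Rₐ(θ_v,u_p)),
where θ_v = 2·arcsin(2k/(1 + √(1 + 4k²⟨v,v₁⟩²))). -/
def gapF (lam k : ℝ) (v₁ v₂ v₃ v : Fin 3 → ℝ) : ℝ :=
  let θ := 2 * Real.arcsin (2 * k / (1 + Real.sqrt (1 + 4 * k^2 * (v ⬝ᵥ v₁)^2)))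
  max
    (max (4 * lam - lam * ((1 : Matrix (Fin 3) (Fin 3) ℝ) -
            Ra π v * Ra θ (-v₁) * Ra θ v₂).trace)
         (4 * lam - lam * ((1 : Matrix (Fin 3) (Fin 3) ℝ) -
            Ra π v * Ra θ (-v₁) * Ra θ (-v₂)).trace))
    (max (4 * lam - lam * ((1 : Matrix (Fin 3) (Fin 3) ℝ) -
            Ra π v * Ra θ (-v₁) * Ra θ v₃).trace)
         (4 * lam - lam * ((1 : Matrix (Fin 3) (Fin 3) ℝ) -
            Ra π v * Ra θ (-v₁) * Ra θ (-v₃)).trace))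

/-- The homogeneous rotation matrix of the quaternion with scalar part `w` and vector part `u`. -/
def quatMatrix (w : ℝ) (u : Fin 3 → ℝ) : Matrix (Fin 3) (Fin 3) ℝ :=
  (w ^ 2 + u ⬝ᵥ u) • (1 : Matrix (Fin 3) (Fin 3) ℝ) + (2 * w) • hat u + (2 : ℝ) • (hat u * hat u)

lemma Ra_eq_quatMatrix {θ c s : ℝ} {u : Fin 3 → ℝ} (hu : u ⬝ᵥ u = 1) (hcs : c ^ 2 + s ^ 2 = 1)
    (hsin : Real.sin θ = 2 * s * c) (hcos : Real.cos θ = 1 - 2 * s ^ 2) :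
    Ra θ u = quatMatrix c (s • u) := by
  have hhat : hat (s • u) = s • hat u := by
    ext i j; fin_cases i <;> fin_cases j <;> simp [hat]
  have hn : c ^ 2 + (s • u) ⬝ᵥ (s • u) = 1 := by
    simp only [smul_dotProduct, dotProduct_smul, hu, smul_eq_mul]; linarith
  rw [Ra, quatMatrix, hn, hhat, hsin, hcos, one_smul, smul_mul_smul_comm, smul_smul, smul_smul]
  congr 2 <;> [congr 1; skip] <;> ring_nf

lemma trace_quatMatrix_mul (p q r : ℝ) (u v w : Fin 3 → ℝ) :
    (quatMatrix p u * quatMatrix q v * quatMatrix r w).trace =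
      4 * (p * q * r - r * (u ⬝ᵥ v) - p * (v ⬝ᵥ w) - q * (u ⬝ᵥ w) - (u ⨯₃ v) ⬝ᵥ w) ^ 2
        - (p ^ 2 + u ⬝ᵥ u) * (q ^ 2 + v ⬝ᵥ v) * (r ^ 2 + w ⬝ᵥ w) := by
  simp [quatMatrix, hat, Matrix.trace, Fin.sum_univ_three, Matrix.mul_apply, dotProduct,
    cross_apply, Matrix.one_apply]
  ring

lemma gap_term_eq {lam θ c s : ℝ} {v v₁ u : Fin 3 → ℝ} (hv : v ⬝ᵥ v = 1) (h1 : v₁ ⬝ᵥ v₁ = 1)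
    (hu : u ⬝ᵥ u = 1) (hcs : c ^ 2 + s ^ 2 = 1) (hsin : Real.sin θ = 2 * s * c)
    (hcos : Real.cos θ = 1 - 2 * s ^ 2) :
    4 * lam - lam * ((1 : Matrix (Fin 3) (Fin 3) ℝ) - Ra π v * Ra θ (-v₁) * Ra θ u).trace =
      4 * lam * (s * (c * (v ⬝ᵥ v₁) - (c * (v ⬝ᵥ u) - s * ((v ⨯₃ v₁) ⬝ᵥ u)))) ^ 2 := by
  have h1' : (-v₁) ⬝ᵥ (-v₁) = 1 := by simpa using h1
  rw [Matrix.trace_sub, Ra_eq_quatMatrix (c := 0) (s := 1) hv (by norm_num) (by simp) (by norm_num),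
    Ra_eq_quatMatrix h1' hcs hsin hcos, Ra_eq_quatMatrix hu hcs hsin hcos, trace_quatMatrix_mul]
  simp [hv, h1, hu]
  have h : c ^ 2 + s * s = 1 := by linarith
  rw [h]
  ring

lemma sum_sq_dotProduct_orthonormal {v₁ v₂ v₃ : Fin 3 → ℝ}
    (h11 : v₁ ⬝ᵥ v₁ = 1) (h22 : v₂ ⬝ᵥ v₂ = 1) (h33 : v₃ ⬝ᵥ v₃ = 1)
    (h12 : v₁ ⬝ᵥ v₂ = 0) (h13 : v₁ ⬝ᵥ v₃ = 0) (h23 : v₂ ⬝ᵥ v₃ = 0) (x y : Fin 3 → ℝ) :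
    (x ⬝ᵥ v₁) * (y ⬝ᵥ v₁) + (x ⬝ᵥ v₂) * (y ⬝ᵥ v₂) + (x ⬝ᵥ v₃) * (y ⬝ᵥ v₃) = x ⬝ᵥ y := by
  let P : Matrix (Fin 3) (Fin 3) ℝ := Matrix.of ![v₁, v₂, v₃]
  have hP : P * Pᵀ = 1 := by
    ext i j
    change ![v₁, v₂, v₃] i ⬝ᵥ ![v₁, v₂, v₃] j = _
    fin_cases i <;> fin_cases j <;>
      simp [h11, h22, h33, h12, h13, h23, dotProduct_comm v₂ v₁, dotProduct_comm v₃ v₁,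
        dotProduct_comm v₃ v₂]
  have hP' : Pᵀ * P = 1 := mul_eq_one_comm.mp hP
  have h : (P *ᵥ x) ⬝ᵥ (P *ᵥ y) = x ⬝ᵥ y := by
    rw [dotProduct_mulVec, vecMul_mulVec, hP', vecMul_one]
  rw [← h]
  simp [P, dotProduct, Matrix.mulVec, Fin.sum_univ_three]
  ring

/-- Parseval for the frame `v₂, v₃` rotated in the plane orthogonal to `v₁`. -/
lemma sq_add_sq_eq {v v₁ v₂ v₃ : Fin 3 → ℝ} {c s : ℝ} (hv : v ⬝ᵥ v = 1)
    (h11 : v₁ ⬝ᵥ v₁ = 1) (h22 : v₂ ⬝ᵥ v₂ = 1) (h33 : v₃ ⬝ᵥ v₃ = 1)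
    (h12 : v₁ ⬝ᵥ v₂ = 0) (h13 : v₁ ⬝ᵥ v₃ = 0) (h23 : v₂ ⬝ᵥ v₃ = 0) (hcs : c ^ 2 + s ^ 2 = 1) :
    (c * (v ⬝ᵥ v₂) - s * ((v ⨯₃ v₁) ⬝ᵥ v₂)) ^ 2 +
      (c * (v ⬝ᵥ v₃) - s * ((v ⨯₃ v₁) ⬝ᵥ v₃)) ^ 2 = 1 - (v ⬝ᵥ v₁) ^ 2 := by
  have parseval := sum_sq_dotProduct_orthonormal h11 h22 h33 h12 h13 h23
  have hvv := parseval v v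
  have hvw := parseval v (v ⨯₃ v₁)
  have hww := parseval (v ⨯₃ v₁) (v ⨯₃ v₁)
  have hw1 : (v ⨯₃ v₁) ⬝ᵥ v₁ = 0 := by rw [dotProduct_comm, dot_cross_self]
  rw [cross_dot_cross, hv, h11, dotProduct_comm v₁ v, hw1] at hww
  rw [dot_self_cross, hw1] at hvw
  rw [hv] at hvv
  linear_combination c ^ 2 * hvv + s ^ 2 * hww - 2 * c * s * hvw + (1 - (v ⬝ᵥ v₁) ^ 2) * hcs

/-- The cubic `x / 2 + k² (1 - x)² (1 / 2 - x)` lies below its chord on `[0, X]`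
by exactly `k² x (X - x) (5 / 2 - X - x)`. -/
lemma min_le_cubic_add {k x X : ℝ} (hX0 : 0 < X) (hX : X = k ^ 2 * (1 - X) ^ 2)
    (hx0 : 0 ≤ x) (hxX : x ≤ X) :
    min (k ^ 2 / 2) (X * (1 - X)) ≤
      x / 2 + k ^ 2 * (1 - x) ^ 2 * (1 / 2 - x) + k ^ 2 * (x * (X - x)) * (5 / 2 - X - x) := by
  set m := min (k ^ 2 / 2) (X * (1 - X))
  have e1 : m ≤ k ^ 2 / 2 := min_le_left _ _
  have e2 : m ≤ X * (1 - X) := min_le_right _ _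
  refine le_of_mul_le_mul_left ?_ hX0
  have h1 := mul_le_mul_of_nonneg_left e1 (sub_nonneg.mpr hxX)
  have h2 := mul_le_mul_of_nonneg_left e2 hx0
  have : X * (x / 2 + k ^ 2 * (1 - x) ^ 2 * (1 / 2 - x)
      + k ^ 2 * (x * (X - x)) * (5 / 2 - X - x)) = (X - x) * (k ^ 2 / 2) + x * (X * (1 - X)) := by
    linear_combination (X * x - x / 2) * hX
  linarith

lemma chord_defect_le {k x X : ℝ} (hk2 : k ^ 2 < 1 / 2) (hX : X ≤ 1 / 2) (hx0 : 0 ≤ x)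
    (hxX : x ≤ X) : k ^ 2 * (x * (X - x)) * (5 / 2 - X - x) ^ 2 ≤ 1 - x * X := by
  have hXX : X * X ≤ 1 / 2 * (1 / 2) := mul_le_mul hX hX (hx0.trans hxX) (by norm_num)
  have hxX' : x * X ≤ X * X := mul_le_mul_of_nonneg_right hxX (hx0.trans hxX)
  have hprod : x * (X - x) ≤ 1 / 16 := by linarith [sq_nonneg (X - 2 * x)]
  have hprod0 : 0 ≤ x * (X - x) := mul_nonneg hx0 (sub_nonneg.mpr hxX)
  have hkp : k ^ 2 * (x * (X - x)) ≤ 1 / 2 * (1 / 16) :=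
    mul_le_mul hk2.le hprod hprod0 (by norm_num)
  have hq : (5 / 2 - X - x) ^ 2 ≤ (5 / 2) ^ 2 := pow_le_pow_left₀ (by linarith) (by linarith) 2
  have hkq := mul_le_mul hkp hq (sq_nonneg _) (by norm_num)
  linarith

lemma min_le_profile {k s a c m X : ℝ} (hk : 0 < k) (hk2 : k ^ 2 < 1 / 2) (hX0 : 0 < X)
    (hX1 : X < 1) (hX : X = k ^ 2 * (1 - X) ^ 2) (hs0 : 0 < s) (hsk : s ≤ k)
    (hs : s = k * (1 - s ^ 2 * a ^ 2)) (hc : 0 ≤ c) (hcs : c ^ 2 + s ^ 2 = 1) (ha : a ^ 2 ≤ 1)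
    (hm : 0 ≤ m) (hm2 : (1 - a ^ 2) / 2 ≤ m ^ 2) :
    min (k ^ 2 / 2) (X * (1 - X)) ≤ (s * (c * |a| + m)) ^ 2 := by
  obtain ⟨x, hx⟩ : ∃ x, x = s ^ 2 * a ^ 2 := ⟨_, rfl⟩
  rw [← hx] at hs
  have hx0 : 0 ≤ x := hx ▸ by positivity
  have hx1 : x < 1 := by nlinarith
  have hss : s ^ 2 = k ^ 2 * (1 - x) ^ 2 := by rw [hs]; ring
  have hxs : x ≤ s ^ 2 := by rw [hx]; nlinarith [sq_nonneg s]
  have hXhalf : X ≤ 1 / 2 := by nlinarith [sq_nonneg (1 - X)]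
  have hxX : x ≤ X := by
    by_contra! h
    nlinarith [mul_pos (sq_pos_of_pos hk) (mul_pos (sub_pos.mpr h)
      (show (0 : ℝ) < 2 - x - X by linarith))]
  have hs2 : s ^ 2 ≤ 1 / 2 := by nlinarith
  have hfac : k ^ 2 * (X - x) * (1 - x * X) ≤ s ^ 2 - x := by
    have : X * (s ^ 2 - x) = k ^ 2 * (X - x) * (1 - x * X) := by
      rw [hss]; linear_combination (-x) * hX
    nlinarith
  have hsm : (s ^ 2 - x) / 2 ≤ s ^ 2 * m ^ 2 := by
    rw [hx]; nlinarith [sq_nonneg s]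
  have hZ : k ^ 2 * (x * (X - x)) * (5 / 2 - X - x) ≤ 2 * (s ^ 2 * c * |a| * m) := by
    refine le_of_abs_le (abs_le_of_sq_le_sq ?_ (by positivity))
    have hZ2 : (2 * (s ^ 2 * c * |a| * m)) ^ 2 = 4 * x * c ^ 2 * (s ^ 2 * m ^ 2) := by
      rw [hx, mul_pow, mul_pow, mul_pow, mul_pow, sq_abs]; ring
    have hxX0 : 0 ≤ X - x := sub_nonneg.mpr hxX
    have hbase : 0 ≤ k ^ 2 * (x * (X - x)) := by positivity
    have hkq := chord_defect_le hk2 hXhalf hx0 hxX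
    have hc2 : 1 / 2 ≤ c ^ 2 := by linarith
    calc (k ^ 2 * (x * (X - x)) * (5 / 2 - X - x)) ^ 2
        = k ^ 2 * (x * (X - x)) * (k ^ 2 * (x * (X - x)) * (5 / 2 - X - x) ^ 2) := by ring
      _ ≤ k ^ 2 * (x * (X - x)) * (1 - x * X) := mul_le_mul_of_nonneg_left hkq hbase
      _ = x * (k ^ 2 * (X - x) * (1 - x * X)) := by ring
      _ ≤ x * (s ^ 2 - x) := mul_le_mul_of_nonneg_left hfac hx0
      _ ≤ x * (2 * (s ^ 2 * m ^ 2)) := mul_le_mul_of_nonneg_left (by linarith) hx0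
      _ = 4 * x * (1 / 2) * (s ^ 2 * m ^ 2) := by ring
      _ ≤ 4 * x * c ^ 2 * (s ^ 2 * m ^ 2) := by gcongr
      _ = (2 * (s ^ 2 * c * |a| * m)) ^ 2 := hZ2.symm
  have hexp : (s * (c * |a| + m)) ^ 2 =
      x * (1 - s ^ 2) + s ^ 2 * m ^ 2 + 2 * (s ^ 2 * c * |a| * m) := by
    have : c ^ 2 = 1 - s ^ 2 := by linarith
    rw [hx, ← this, ← sq_abs a]; ring
  have hcubic := min_le_cubic_add hX0 hX hx0 hxX
  rw [← hss] at hcubic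
  rw [hexp]
  linarith

lemma max_sq_sub_sq_add (A q : ℝ) : max ((A - q) ^ 2) ((A + q) ^ 2) = (|A| + |q|) ^ 2 := by
  have h := mul_nonneg (abs_nonneg A) (abs_nonneg q)
  rcases abs_cases A with ⟨hA, _⟩ | ⟨hA, _⟩ <;> rcases abs_cases q with ⟨hq, _⟩ | ⟨hq, _⟩ <;>
    rw [hA, hq] at h ⊢ <;>
    first
    | exact (max_eq_right (by nlinarith)).trans (by ring)
    | exact (max_eq_left (by nlinarith)).trans (by ring)

/-- `warpSin k a` is the sine of half the warping angle at a critical point whose axis has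
component `a` along the warping direction. -/
def warpSin (k a : ℝ) : ℝ := 2 * k / (1 + Real.sqrt (1 + 4 * k ^ 2 * a ^ 2))

lemma warpSin_pos {k : ℝ} (hk : 0 < k) (a : ℝ) : 0 < warpSin k a := by
  unfold warpSin; positivity

lemma warpSin_eq {k : ℝ} (hk : 0 < k) (a : ℝ) :
    warpSin k a = k * (1 - warpSin k a ^ 2 * a ^ 2) := by
  have hr : Real.sqrt (1 + 4 * k ^ 2 * a ^ 2) ^ 2 = 1 + 4 * k ^ 2 * a ^ 2 :=
    Real.sq_sqrt (by positivity)
  have hr0 := Real.sqrt_nonneg (1 + 4 * k ^ 2 * a ^ 2)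
  unfold warpSin
  generalize Real.sqrt (1 + 4 * k ^ 2 * a ^ 2) = r at hr hr0
  have : 1 + r ≠ 0 := by positivity
  field_simp
  linear_combination (-1) * hr

lemma warpSin_le {k : ℝ} (hk : 0 < k) (a : ℝ) : warpSin k a ≤ k := by
  have := warpSin_eq hk a
  have h : 0 ≤ k * (warpSin k a ^ 2 * a ^ 2) := by positivity
  linarith

lemma gapF_eq {lam k : ℝ} (hlam : 0 < lam) (hk : 0 < k) (hk2 : k ^ 2 < 1 / 2)
    {v₁ v₂ v₃ v : Fin 3 → ℝ} (hv : v ⬝ᵥ v = 1)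
    (h11 : v₁ ⬝ᵥ v₁ = 1) (h22 : v₂ ⬝ᵥ v₂ = 1) (h33 : v₃ ⬝ᵥ v₃ = 1) {s c : ℝ}
    (hs : s = warpSin k (v ⬝ᵥ v₁)) (hc : c = Real.sqrt (1 - s ^ 2)) :
    gapF lam k v₁ v₂ v₃ v = 4 * lam * (s * (c * |v ⬝ᵥ v₁| +
      max |c * (v ⬝ᵥ v₂) - s * ((v ⨯₃ v₁) ⬝ᵥ v₂)| |c * (v ⬝ᵥ v₃) - s * ((v ⨯₃ v₁) ⬝ᵥ v₃)|)) ^ 2 := by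
  have hs0 : 0 < s := hs ▸ warpSin_pos hk _
  have hsk : s ≤ k := hs ▸ warpSin_le hk _
  have hs1 : s ≤ 1 := by nlinarith
  have hc0 : 0 ≤ c := hc ▸ Real.sqrt_nonneg _
  have hcs : c ^ 2 + s ^ 2 = 1 := by
    rw [hc, Real.sq_sqrt (by nlinarith)]; ring
  have hasin : Real.sin (Real.arcsin s) = s := Real.sin_arcsin (by linarith) hs1
  have hsin : Real.sin (2 * Real.arcsin s) = 2 * s * c := by
    rw [Real.sin_two_mul, hasin, Real.cos_arcsin, hc]
  have hcos : Real.cos (2 * Real.arcsin s) = 1 - 2 * s ^ 2 := by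
    rw [Real.cos_two_mul, Real.cos_arcsin, Real.sq_sqrt (by nlinarith)]; ring
  have hpair : ∀ u : Fin 3 → ℝ, u ⬝ᵥ u = 1 →
      max (4 * lam - lam * ((1 : Matrix (Fin 3) (Fin 3) ℝ) -
            Ra π v * Ra (2 * Real.arcsin s) (-v₁) * Ra (2 * Real.arcsin s) u).trace)
          (4 * lam - lam * ((1 : Matrix (Fin 3) (Fin 3) ℝ) -
            Ra π v * Ra (2 * Real.arcsin s) (-v₁) * Ra (2 * Real.arcsin s) (-u)).trace) =
        4 * lam * (s * (c * |v ⬝ᵥ v₁| + |c * (v ⬝ᵥ u) - s * ((v ⨯₃ v₁) ⬝ᵥ u)|)) ^ 2 := by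
    intro u hu
    rw [gap_term_eq hv h11 hu hcs hsin hcos,
      gap_term_eq hv h11 (u := -u) (by simpa using hu) hcs hsin hcos,
      ← mul_max_of_nonneg _ _ (by positivity), mul_pow, mul_pow,
      ← mul_max_of_nonneg _ _ (by positivity), mul_pow, ← abs_of_nonneg hc0, ← abs_mul,
      ← max_sq_sub_sq_add, abs_of_nonneg hc0]
    simp only [dotProduct_neg]
    ring_nf
  unfold gapF
  rw [← warpSin, ← hs]
  simp only
  rw [hpair v₂ h22, hpair v₃ h33, ← mul_max_of_nonneg _ _ (by positivity)]
  congr 1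
  have hmono : MonotoneOn (fun y : ℝ => (s * (c * |v ⬝ᵥ v₁| + y)) ^ 2) (Set.Ici 0) := by
    intro y hy z _ hyz
    have hy : (0 : ℝ) ≤ y := hy
    dsimp only
    gcongr
  exact (hmono.map_max (Set.mem_Ici.mpr (abs_nonneg _)) (Set.mem_Ici.mpr (abs_nonneg _))).symm

/-- Theorem 2, case (1): the refined synergistic gap is bounded below by
2λ·min{k², 2Ξ²(1 − Ξ²)} with Ξ = 2k/(1 + √(1 + 4k²)), and this bound is
attained. -/
theorem refined_gap_lower_bound_identity_case
    (lam k : ℝ) (hlam : 0 < lam) (hk : 0 < k) (hk2 : k < 1 / Real.sqrt 2)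
    (v₁ v₂ v₃ : Fin 3 → ℝ)
    (h11 : v₁ ⬝ᵥ v₁ = 1) (h22 : v₂ ⬝ᵥ v₂ = 1) (h33 : v₃ ⬝ᵥ v₃ = 1)
    (h12 : v₁ ⬝ᵥ v₂ = 0) (h13 : v₁ ⬝ᵥ v₃ = 0) (h23 : v₂ ⬝ᵥ v₃ = 0)
    (M : Matrix (Fin 3) (Fin 3) ℝ)
    (hMdef : M = lam • (1 : Matrix (Fin 3) (Fin 3) ℝ))
    (Ξ : ℝ) (hΞ : Ξ = 2 * k / (1 + Real.sqrt (1 + 4 * k^2))) :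
    (∀ v : Fin 3 → ℝ, v ⬝ᵥ v = 1 →
      2 * lam * min (k^2) (2 * Ξ^2 * (1 - Ξ^2)) ≤ gapF lam k v₁ v₂ v₃ v) ∧
    (∃ v₀ : Fin 3 → ℝ, v₀ ⬝ᵥ v₀ = 1 ∧
      gapF lam k v₁ v₂ v₃ v₀ = 2 * lam * min (k^2) (2 * Ξ^2 * (1 - Ξ^2))) := by
  have hk2' : k ^ 2 < 1 / 2 := by
    have h := pow_lt_pow_left₀ hk2 hk.le two_ne_zero
    rwa [div_pow, Real.sq_sqrt (by norm_num), one_pow] at h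
  have hΞ' : Ξ = warpSin k 1 := by rw [hΞ, warpSin]; norm_num
  have hΞ0 : 0 < Ξ := hΞ' ▸ warpSin_pos hk 1
  have hΞk : Ξ ≤ k := hΞ' ▸ warpSin_le hk 1
  have hΞeq : Ξ = k * (1 - Ξ ^ 2) := by
    have h := warpSin_eq hk 1
    rw [← hΞ'] at h
    linarith
  have hΞ1 : Ξ ^ 2 < 1 := by nlinarith
  have hmin : 2 * lam * min (k ^ 2) (2 * Ξ ^ 2 * (1 - Ξ ^ 2)) =
      4 * lam * min (k ^ 2 / 2) (Ξ ^ 2 * (1 - Ξ ^ 2)) := by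
    rw [show k ^ 2 = 2 * (k ^ 2 / 2) by ring,
      show 2 * Ξ ^ 2 * (1 - Ξ ^ 2) = 2 * (Ξ ^ 2 * (1 - Ξ ^ 2)) by ring,
      ← mul_min_of_nonneg _ _ (zero_le_two)]
    ring_nf
  rw [hmin]
  refine ⟨fun v hv => ?_, ?_⟩
  · rw [gapF_eq hlam hk hk2' hv h11 h22 h33 rfl rfl]
    set s := warpSin k (v ⬝ᵥ v₁)
    set c := Real.sqrt (1 - s ^ 2) with hc
    have hsk : s ≤ k := warpSin_le hk _
    have hs0 : 0 < s := warpSin_pos hk _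
    have hcs : c ^ 2 + s ^ 2 = 1 := by
      rw [hc, Real.sq_sqrt (by nlinarith)]; ring
    have hsum := sq_add_sq_eq hv h11 h22 h33 h12 h13 h23 hcs
    set q₂ := c * (v ⬝ᵥ v₂) - s * ((v ⨯₃ v₁) ⬝ᵥ v₂)
    set q₃ := c * (v ⬝ᵥ v₃) - s * ((v ⨯₃ v₁) ⬝ᵥ v₃)
    have hq₂ : q₂ ^ 2 ≤ max |q₂| |q₃| ^ 2 := by
      rw [← sq_abs q₂]; gcongr; exact le_max_left _ _
    have hq₃ : q₃ ^ 2 ≤ max |q₂| |q₃| ^ 2 := by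
      rw [← sq_abs q₃]; gcongr; exact le_max_right _ _
    refine mul_le_mul_of_nonneg_left ?_ (by positivity)
    exact min_le_profile hk hk2' (by positivity) hΞ1
      (by rw [← mul_pow, ← hΞeq]) hs0 hsk (warpSin_eq hk _) (Real.sqrt_nonneg _) hcs
      (by nlinarith) (le_max_of_le_left (abs_nonneg _)) (by linarith)
  · rcases le_total (k ^ 2 / 2) (Ξ ^ 2 * (1 - Ξ ^ 2)) with hle | hle
    · rw [min_eq_left hle]
      obtain ⟨c, hc⟩ : ∃ c, c = Real.sqrt (1 - k ^ 2) := ⟨_, rfl⟩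
      have hck : c ^ 2 + k ^ 2 = 1 := by
        rw [hc, Real.sq_sqrt (by linarith)]; ring
      have h21 : v₂ ⬝ᵥ v₁ = 0 := by rw [dotProduct_comm, h12]
      have h31 : v₃ ⬝ᵥ v₁ = 0 := by rw [dotProduct_comm, h13]
      have h32 : v₃ ⬝ᵥ v₂ = 0 := by rw [dotProduct_comm, h23]
      obtain ⟨δ, hδ⟩ : ∃ δ, δ = (v₃ ⨯₃ v₁) ⬝ᵥ v₂ := ⟨_, rfl⟩
      have hδ' : (v₂ ⨯₃ v₁) ⬝ᵥ v₃ = -δ := by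
        rw [hδ, dotProduct_comm, dotProduct_comm _ v₂, triple_product_permutation,
          ← cross_anticomm, dotProduct_neg, triple_product_permutation, neg_inj,
          triple_product_permutation]
      have h212 : (v₂ ⨯₃ v₁) ⬝ᵥ v₂ = 0 := by rw [dotProduct_comm, dot_self_cross]
      have h313 : (v₃ ⨯₃ v₁) ⬝ᵥ v₃ = 0 := by rw [dotProduct_comm, dot_self_cross]
      have hδ2 : δ ^ 2 = 1 := by
        have h := sum_sq_dotProduct_orthonormal h11 h22 h33 h12 h13 h23 (v₃ ⨯₃ v₁) (v₃ ⨯₃ v₁)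
        rw [cross_dot_cross, h33, h11, h31, h13, h313, ← hδ,
          dotProduct_comm (v₃ ⨯₃ v₁) v₁, dot_cross_self] at h
        linarith
      obtain ⟨r, hr⟩ : ∃ r : ℝ, r ^ 2 = 1 / 2 := ⟨Real.sqrt (1 / 2), Real.sq_sqrt (by norm_num)⟩
      obtain ⟨y, hy⟩ : ∃ y, y = r * (c + k * δ) := ⟨_, rfl⟩
      obtain ⟨z, hz⟩ : ∃ z, z = r * (c - k * δ) := ⟨_, rfl⟩
      obtain ⟨v, hvdef⟩ : ∃ v, v = y • v₂ + z • v₃ := ⟨_, rfl⟩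
      have hv : v ⬝ᵥ v = 1 := by
        simp only [hvdef, add_dotProduct, dotProduct_add, smul_dotProduct, dotProduct_smul,
          smul_eq_mul, h22, h33, h23, h32, hy, hz]
        linear_combination 2 * r ^ 2 * hck + 2 * r ^ 2 * k ^ 2 * hδ2 + 2 * hr
      have ha : v ⬝ᵥ v₁ = 0 := by simp [hvdef, h21, h31]
      have hq₂ : c * (v ⬝ᵥ v₂) - k * ((v ⨯₃ v₁) ⬝ᵥ v₂) = r := by
        simp only [hvdef, map_add, map_smul, LinearMap.add_apply, LinearMap.smul_apply,
          add_dotProduct, smul_dotProduct, smul_eq_mul, h22, h32, h212, ← hδ, hy, hz]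
        linear_combination r * hck + r * k ^ 2 * hδ2
      have hq₃ : c * (v ⬝ᵥ v₃) - k * ((v ⨯₃ v₁) ⬝ᵥ v₃) = r := by
        simp only [hvdef, map_add, map_smul, LinearMap.add_apply, LinearMap.smul_apply,
          add_dotProduct, smul_dotProduct, smul_eq_mul, h33, h23, h313, hδ', hy, hz]
        linear_combination r * hck + r * k ^ 2 * hδ2
      have hs : k = warpSin k (v ⬝ᵥ v₁) := by
        have h := warpSin_eq hk (v ⬝ᵥ v₁)
        rw [ha] at h ⊢
        linarith
      refine ⟨v, hv, ?_⟩
      rw [gapF_eq hlam hk hk2' hv h11 h22 h33 hs hc, hq₂, hq₃, ha, max_self, abs_zero, mul_zero,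
        zero_add, mul_pow, sq_abs, hr]
      ring
    · rw [min_eq_right hle]
      refine ⟨v₁, h11, ?_⟩
      rw [gapF_eq hlam hk hk2' h11 h11 h22 h33 (s := Ξ) (by rw [h11, hΞ']) rfl, h11, h12, h13,
        cross_self]
      simp only [zero_dotProduct, mul_zero, sub_zero, abs_zero, max_self, abs_one, mul_one,
        add_zero]
      rw [mul_pow, Real.sq_sqrt (by linarith)]

end
end
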